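/- Bernstein's inequality: for any real polynomial P of degree n and any x with −1 < x < 1, |P'(x)| ≤ (n/√(1−x²)) · sup_{t∈[−1,1]} |P(t)|. -/

import Mathlib

open Polynomial

namespace BernsteinInequality

open Real Finset

/-- The angles `(2k + 1)π / (2n)`, at which `cos (n θ)` vanishes. -/
noncomputable def rieszNode (n k : ℕ) : ℝ := (2 * k + 1) * π / (2 * n)

/-- The signed weights of M. Riesz's interpolation formula. -/
noncomputable def rieszWeight (n k : ℕ) : ℝ :=
  sin (n * rieszNode n k) / (2 * n * (1 - cos (rieszNode n k)))

variable {n : ℕ}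

lemma cos_mul_rieszNode (hn : 0 < n) (k : ℕ) : cos (n * rieszNode n k) = 0 := by
  rw [Real.cos_eq_zero_iff]
  refine ⟨k, ?_⟩
  unfold rieszNode
  push_cast
  field_simp

lemma sin_sq_mul_rieszNode (hn : 0 < n) (k : ℕ) : sin (n * rieszNode n k) ^ 2 = 1 := by
  simp [Real.sin_sq, cos_mul_rieszNode hn k]

lemma cos_rieszNode_lt_one {k : ℕ} (hk : k < 2 * n) : cos (rieszNode n k) < 1 := by
  have hn : (0 : ℝ) < n := by exact_mod_cast (by omega : 0 < n)
  have hk' : (k : ℝ) + 1 ≤ 2 * n := by exact_mod_cast hk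
  have hpos : 0 < rieszNode n k := by unfold rieszNode; positivity
  have hlt : rieszNode n k < 2 * π := by
    unfold rieszNode
    rw [div_lt_iff₀ (by positivity)]
    nlinarith [pi_pos]
  refine lt_of_le_of_ne (cos_le_one _) fun h => hpos.ne' ?_
  exact (Real.cos_eq_one_iff_of_lt_of_lt (by linarith) hlt).1 h

lemma sum_cos_mul_rieszNode {m : ℕ} (hm : 0 < m) (hmn : m < 2 * n) :
    ∑ k ∈ range (2 * n), cos (m * rieszNode n k) = 0 := by
  have hn : (0 : ℝ) < n := by exact_mod_cast (by omega : 0 < n)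
  have hm' : (0 : ℝ) < m := by exact_mod_cast hm
  have hmn' : (m : ℝ) < 2 * n := by exact_mod_cast hmn
  set h : ℝ := m * π / (2 * n) with hh
  have hsin : 0 < sin h := by
    refine sin_pos_of_pos_of_lt_pi (by positivity) ?_
    rw [hh, div_lt_iff₀ (by positivity)]
    nlinarith [pi_pos]
  have hterm (k : ℕ) : 2 * sin h * cos (m * rieszNode n k) =
      sin (2 * (k + 1 : ℕ) * h) - sin (2 * k * h) := by
    rw [Real.sin_sub_sin]
    congr 2
    · congr 1; push_cast; ring
    · rw [rieszNode, hh]; push_cast; ring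
  have hsum : 2 * sin h * ∑ k ∈ range (2 * n), cos (m * rieszNode n k) = 0 := by
    rw [mul_sum, sum_congr rfl fun k _ => hterm k,
      sum_range_sub fun k : ℕ => sin (2 * k * h)]
    have : (2 * (2 * n : ℕ) * h : ℝ) = (2 * m : ℕ) * π := by
      rw [hh]; push_cast; field_simp
    rw [this, sin_nat_mul_pi]
    simp
  exact (mul_eq_zero.1 hsum).resolve_left (by positivity)

lemma sum_sin_mul_sin_rieszNode {j : ℕ} (hj : 0 < j) (hjn : j < n) :
    ∑ k ∈ range (2 * n), sin (n * rieszNode n k) * sin (j * rieszNode n k) = 0 := by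
  have hterm (k : ℕ) : sin (n * rieszNode n k) * sin (j * rieszNode n k) =
      (cos ((n - j : ℕ) * rieszNode n k) - cos ((n + j : ℕ) * rieszNode n k)) / 2 := by
    rw [Nat.cast_sub hjn.le, Nat.cast_add, sub_mul, add_mul, cos_sub, cos_add]
    ring
  rw [sum_congr rfl fun k _ => hterm k, ← sum_div, sum_sub_distrib,
    sum_cos_mul_rieszNode (by omega) (by omega), sum_cos_mul_rieszNode (by omega) (by omega)]
  simp

lemma rieszWeight_mul_one_sub_cos {k : ℕ} (hk : k < 2 * n) :
    rieszWeight n k * (2 * (1 - cos (rieszNode n k))) = sin (n * rieszNode n k) / n := by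
  have hn : (n : ℝ) ≠ 0 := by exact_mod_cast (by omega : n ≠ 0)
  have := (sub_pos.2 (cos_rieszNode_lt_one hk)).ne'
  unfold rieszWeight
  field_simp

/-- The moments `∑ wₖ sin (j θₖ)` have second difference `-(1/n) ∑ sin (n θₖ) sin (j θₖ)`. -/
lemma rieszMoment_second_difference (j : ℕ) :
    ∑ k ∈ range (2 * n), rieszWeight n k * sin ((j + 2 : ℕ) * rieszNode n k) =
      2 * ∑ k ∈ range (2 * n), rieszWeight n k * sin ((j + 1 : ℕ) * rieszNode n k) -
      ∑ k ∈ range (2 * n), rieszWeight n k * sin (j * rieszNode n k) -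
      (∑ k ∈ range (2 * n), sin (n * rieszNode n k) * sin ((j + 1 : ℕ) * rieszNode n k)) / n := by
  rw [mul_sum, sum_div, ← sum_sub_distrib, ← sum_sub_distrib]
  refine sum_congr rfl fun k hk => ?_
  have hw := rieszWeight_mul_one_sub_cos (mem_range.1 hk)
  have h2 : sin ((j + 2 : ℕ) * rieszNode n k) =
      2 * cos (rieszNode n k) * sin ((j + 1 : ℕ) * rieszNode n k) - sin (j * rieszNode n k) := by
    have e2 : ((j + 2 : ℕ) : ℝ) * rieszNode n k = (j + 1 : ℕ) * rieszNode n k + rieszNode n k := by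
      push_cast; ring
    have e0 : (j : ℝ) * rieszNode n k = (j + 1 : ℕ) * rieszNode n k - rieszNode n k := by
      push_cast; ring
    rw [e2, e0, sin_add, sin_sub]
    ring
  rw [h2, mul_div_right_comm, ← hw]
  ring

lemma rieszMoment_eq_mul {j : ℕ} (hj : j ≤ n) :
    ∑ k ∈ range (2 * n), rieszWeight n k * sin (j * rieszNode n k) =
      j * ∑ k ∈ range (2 * n), rieszWeight n k * sin ((1 : ℕ) * rieszNode n k) := by
  induction j using Nat.strong_induction_on with
  | _ j ih =>
    match j with
    | 0 => simp
    | 1 => simp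
    | i + 2 =>
      rw [rieszMoment_second_difference, sum_sin_mul_sin_rieszNode (by omega) (by omega),
        ih (i + 1) (by omega) (by omega), ih i (by omega) (by omega)]
      push_cast
      ring

lemma rieszMoment_eq {j : ℕ} (hj : j ≤ n) :
    ∑ k ∈ range (2 * n), rieszWeight n k * sin (j * rieszNode n k) = j := by
  rcases Nat.eq_zero_or_pos n with rfl | hn
  · simp [Nat.le_zero.1 hj]
  obtain ⟨m, rfl⟩ : ∃ m, n = m + 1 := ⟨n - 1, by omega⟩
  set N := m + 1 with hN
  have hsymm : ∑ k ∈ range (2 * N), rieszWeight N k * sin ((m + 2 : ℕ) * rieszNode N k) =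
      ∑ k ∈ range (2 * N), rieszWeight N k * sin (m * rieszNode N k) := by
    refine sum_congr rfl fun k _ => ?_
    have e2 : ((m + 2 : ℕ) : ℝ) * rieszNode N k = N * rieszNode N k + rieszNode N k := by
      rw [hN]; push_cast; ring
    have e0 : (m : ℝ) * rieszNode N k = N * rieszNode N k - rieszNode N k := by
      rw [hN]; push_cast; ring
    rw [e2, e0, sin_add, sin_sub, cos_mul_rieszNode hn]
    ring
  have hsq : ∑ k ∈ range (2 * N), sin (N * rieszNode N k) * sin (N * rieszNode N k) = 2 * N := by
    rw [sum_congr rfl fun k _ => (sq _).symm.trans (sin_sq_mul_rieszNode hn k)]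
    simp
  have hrec := rieszMoment_second_difference (n := N) m
  have hm := rieszMoment_eq_mul (n := N) (j := m) (by omega)
  have hN' := rieszMoment_eq_mul (n := N) le_rfl
  rw [hsymm, ← hN, hsq, hN', hm, hN] at hrec
  have hne : ((m + 1 : ℕ) : ℝ) ≠ 0 := by positivity
  rw [mul_div_assoc, div_self hne] at hrec
  push_cast at hrec
  rw [rieszMoment_eq_mul hj]
  have hone : ∑ k ∈ range (2 * N), rieszWeight N k * sin ((1 : ℕ) * rieszNode N k) = 1 := by
    rw [hN]; push_cast; linarith
  rw [hone, mul_one]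

lemma sum_abs_rieszWeight (hn : 0 < n) : ∑ k ∈ range (2 * n), |rieszWeight n k| = n := by
  rw [← rieszMoment_eq (n := n) le_rfl]
  refine sum_congr rfl fun k hk => ?_
  have hpos : 0 ≤ 2 * n * (1 - cos (rieszNode n k)) :=
    mul_nonneg (by positivity) (sub_pos.2 (cos_rieszNode_lt_one (mem_range.1 hk))).le
  have habs : |sin (n * rieszNode n k)| = 1 := by
    rw [← sq_eq_sq₀ (abs_nonneg _) zero_le_one, sq_abs, sin_sq_mul_rieszNode hn, one_pow]
  rw [rieszWeight, abs_div, habs, abs_of_nonneg hpos, div_mul_eq_mul_div, ← sq,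
    sin_sq_mul_rieszNode hn]

/-- M. Riesz's interpolation formula for the even trigonometric polynomial `P (cos θ)`. -/
theorem riesz_interpolation {P : ℝ[X]} (hP : P.natDegree ≤ n) (θ : ℝ) :
    sin θ * P.derivative.eval (cos θ) = ∑ k ∈ range (2 * n), rieszWeight n k *
      ((P.eval (cos (θ - rieszNode n k)) - P.eval (cos (θ + rieszNode n k))) / 2) := by
  have hmem : P ∈ degreeLE ℝ n := mem_degreeLE.2 (natDegree_le_iff_degree_le.1 hP)
  rw [← Sequence.span_degreeLE (Chebyshev.chebyshevTsequence ℝ) (by simp)] at hmem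
  clear hP
  induction hmem using Submodule.span_induction with
  | mem Q hQ =>
    obtain ⟨j, hj, rfl⟩ := hQ
    have hj : j ≤ n := hj
    change sin θ * (derivative (Chebyshev.T ℝ j)).eval (cos θ) = ∑ k ∈ range (2 * n),
      rieszWeight n k * (((Chebyshev.T ℝ j).eval (cos (θ - rieszNode n k)) -
        (Chebyshev.T ℝ j).eval (cos (θ + rieszNode n k))) / 2)
    have hU := Chebyshev.U_real_cos θ ((j : ℤ) - 1)
    rw [Chebyshev.T_derivative_eq_U, eval_mul]
    simp only [Chebyshev.T_real_cos]
    push_cast at hU ⊢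
    rw [sub_add_cancel] at hU
    calc sin θ * (eval (cos θ) (j : ℝ[X]) * eval (cos θ) (Chebyshev.U ℝ (j - 1)))
        = sin (j * θ) * j := by rw [eval_natCast, ← hU]; ring
      _ = ∑ k ∈ range (2 * n), sin (j * θ) * (rieszWeight n k * sin (j * rieszNode n k)) := by
          rw [← mul_sum, rieszMoment_eq hj]
      _ = _ := by
          refine sum_congr rfl fun k _ => ?_
          rw [mul_sub, mul_add, cos_sub, cos_add]
          ring
  | zero => simp
  | add Q R _ _ hQ hR =>
    simp only [derivative_add, eval_add, mul_add, hQ, hR, ← sum_add_distrib]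
    exact sum_congr rfl fun k _ => by ring
  | smul c Q _ hQ =>
    simp only [derivative_smul, eval_smul, smul_eq_mul]
    rw [mul_left_comm, hQ, mul_sum]
    exact sum_congr rfl fun k _ => by ring

end BernsteinInequality

open BernsteinInequality in
theorem bernstein_inequality (n : ℕ) (P : Polynomial ℝ) (hP : P.natDegree ≤ n)
    (C : ℝ) (hC : ∀ t ∈ Set.Icc (-1 : ℝ) 1, |P.eval t| ≤ C)
    (x : ℝ) (hx : -1 < x) (hx' : x < 1) :
    |P.derivative.eval x| ≤ (n / Real.sqrt (1 - x ^ 2)) * C := by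
  rcases Nat.eq_zero_or_pos n with rfl | hn
  · rw [derivative_of_natDegree_zero (Nat.le_zero.1 hP)]
    simp
  have hs : 0 < Real.sqrt (1 - x ^ 2) := Real.sqrt_pos.2 (by nlinarith)
  have key := riesz_interpolation hP (Real.arccos x)
  rw [Real.sin_arccos, Real.cos_arccos hx.le hx'.le] at key
  rw [div_mul_eq_mul_div, le_div_iff₀ hs, mul_comm, ← abs_of_pos hs, ← abs_mul, key,
    ← sum_abs_rieszWeight hn, Finset.sum_mul]
  refine (Finset.abs_sum_le_sum_abs _ _).trans (Finset.sum_le_sum fun k _ => ?_)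
  rw [abs_mul]
  refine mul_le_mul_of_nonneg_left ?_ (abs_nonneg _)
  have hminus := hC _ (Real.cos_mem_Icc (Real.arccos x - rieszNode n k))
  have hplus := hC _ (Real.cos_mem_Icc (Real.arccos x + rieszNode n k))
  rw [abs_le] at hminus hplus ⊢
  constructor <;> linarith [hminus.1, hminus.2, hplus.1, hplus.2]
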